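/- Let L_n → ∞ and N_n ∈ ℕ with N_n/L_n^d → ρ, where ρ > ρ_c. Write z₀ = z₀(L_n, N_n), and for k ∈ ℤ^d set p_k^{(N_n)} = z₀ g_k^{(L_n)}/(1 − z₀ g_k^{(L_n)}), with p_0^{(N_n)} = z₀/(1 − z₀). Then p_0^{(N_n)} · (1/(2πi)) ∮_{|η|=1} dη / ( η^{N_n+1} Π_{k ∈ ℤ^d} (1 − p_k^{(N_n)}(η−1)) ) → 1/e as n → ∞. -/

import Mathlib

open MeasureTheory Filter

noncomputable section

/-- the eigenvalue `g_k^{(L)} = exp(-β|2πk/L|²)` of the periodic heat operator. -/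
def gk (d : ℕ) (β L : ℝ) (k : Fin d → ℤ) : ℝ :=
  Real.exp (-β * ∑ i, (2 * Real.pi * (k i : ℝ) / L) ^ 2)

/-- `a₁(p;1) = e^{-β|p|²}/(1 - e^{-β|p|²})`; `ρ_c = ∫ a₁(p;1) dp/(2π)^d`. -/
def a1crit (d : ℕ) (β : ℝ) (p : EuclideanSpace ℝ (Fin d)) : ℝ :=
  Real.exp (-β * ‖p‖ ^ 2) / (1 - Real.exp (-β * ‖p‖ ^ 2))

/-- `p_k^{(N)} = z₀ g_k^{(L)}/(1 - z₀ g_k^{(L)})`. -/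
def pk (d : ℕ) (β L z : ℝ) (k : Fin d → ℤ) : ℝ :=
  z * gk d β L k / (1 - z * gk d β L k)


lemma residue_aux (F : ℂ → ℂ) (w R : ℝ) (h1 : 1 < w) (hR : w < R)
    (hF : ∀ η : ℂ, 1 ≤ ‖η‖ → ‖η‖ ≤ R → DifferentiableAt ℂ F η) :
    (∮ η in C(0, 1), ((w : ℂ) - η)⁻¹ * F η) =
      2 * Real.pi * Complex.I * F w - ∮ η in C(0, R), (η - w)⁻¹ * F η := by
  have hR0 : 0 < R := by linarith
  have hwn : ‖(w : ℂ)‖ = w := by rw [Complex.norm_real, Real.norm_of_nonneg (by linarith)]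
  have hdw : DifferentiableAt ℂ F w := hF _ (by rw [hwn]; linarith) (by rw [hwn]; linarith)
  have key := Complex.circleIntegral_sub_center_inv_smul_eq_of_differentiable_on_annulus_off_countable
    (c := 0) (r := 1) (R := R) one_pos (by linarith) (f := fun η => η * dslope F w η)
    (s := {(w : ℂ)}) (Set.countable_singleton _)
    (by
      intro η hη
      have hη1 : ‖η‖ ≤ R := by simpa using hη.1
      have hη2 : 1 ≤ ‖η‖ := by simpa using hη.2
      apply ContinuousAt.continuousWithinAt
      apply continuousAt_id.mul
      by_cases h : η = w
      · rw [h]; exact continuousAt_dslope_same.2 hdw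
      · exact (continuousAt_dslope_of_ne h).2 (hF η hη2 hη1).continuousAt)
    (by
      intro η hη
      have hη1 : ‖η‖ < R := by simpa using hη.1.1
      have hη2 : 1 < ‖η‖ := by simpa using hη.1.2
      have h : η ≠ w := by simpa using hη.2
      exact differentiableAt_id.mul ((differentiableAt_dslope_of_ne h).2 (hF η hη2.le hη1.le)))
  have gen : ∀ r : ℝ, 1 ≤ r → r ≤ R → r ≠ w →
      (∮ η in C(0, r), (η - 0)⁻¹ • (η * dslope F w η)) =
        (∮ η in C(0, r), (η - w)⁻¹ * F η) - (∮ η in C(0, r), (η - (w : ℂ))⁻¹) * F w := by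
    intro r hr1 hr2 hrw
    have hr0 : 0 ≤ r := by linarith
    have hne : ∀ η ∈ Metric.sphere (0 : ℂ) r, η ≠ w ∧ η ≠ 0 ∧ 1 ≤ ‖η‖ ∧ ‖η‖ ≤ R := by
      intro η hη
      have : ‖η‖ = r := by simpa using hη
      refine ⟨?_, ?_, by linarith, by linarith⟩
      · rintro rfl; exact hrw (by rw [← this, hwn])
      · rintro rfl; simp at this; linarith
    have hci : ContinuousOn (fun η : ℂ => (η - (w : ℂ))⁻¹) (Metric.sphere 0 r) := by
      apply ContinuousOn.inv₀ (by fun_prop)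
      intro η hη; exact sub_ne_zero.2 (hne η hη).1
    have hcF : ContinuousOn F (Metric.sphere 0 r) := fun η hη =>
      (hF η (hne η hη).2.2.1 (hne η hη).2.2.2).continuousAt.continuousWithinAt
    have hi1 : CircleIntegrable (fun η : ℂ => (η - (w : ℂ))⁻¹ * F η) 0 r :=
      (hci.mul hcF).circleIntegrable hr0
    have hi2 : CircleIntegrable (fun η : ℂ => (η - (w : ℂ))⁻¹ * F w) 0 r :=
      (hci.mul continuousOn_const).circleIntegrable hr0
    rw [mul_comm (∮ η in C(0, r), (η - (w : ℂ))⁻¹), ← circleIntegral.integral_const_mul]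
    simp_rw [mul_comm (F w)]
    rw [← circleIntegral.integral_sub hi1 hi2]
    apply circleIntegral.integral_congr hr0
    intro η hη
    have h := hne η hη
    simp only [sub_zero, smul_eq_mul]
    rw [dslope_of_ne _ h.1, slope_def_field, ← mul_assoc, inv_mul_cancel₀ h.2.1]
    ring
  rw [gen R (by linarith) le_rfl (by linarith), gen 1 le_rfl (by linarith) (by linarith),
    circleIntegral.integral_sub_inv_of_mem_ball (by simp; rwa [abs_of_pos (by linarith)])] at key
  have h0 : (∮ η in C(0, 1), (η - (w : ℂ))⁻¹) = 0 := by
    have hne : ∀ η : ℂ, ‖η‖ ≤ 1 → η - w ≠ 0 := by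
      intro η hη h
      rw [sub_eq_zero] at h
      rw [h, hwn] at hη; linarith
    apply Complex.circleIntegral_eq_zero_of_differentiable_on_off_countable zero_le_one
      (Set.countable_empty)
    · apply ContinuousOn.inv₀ (by fun_prop)
      intro η hη; exact hne η (by simpa using hη)
    · intro η hη
      have : ‖η‖ < 1 := by simpa using hη
      exact (differentiableAt_id.sub_const _).inv (hne η this.le)
  rw [h0, zero_mul, sub_zero] at key
  have hneg : (∮ η in C(0, 1), ((w : ℂ) - η)⁻¹ * F η) = - ∮ η in C(0, 1), (η - w)⁻¹ * F η := by
    have : (fun η : ℂ => ((w : ℂ) - η)⁻¹ * F η) = fun η : ℂ => (-1 : ℂ) * ((η - w)⁻¹ * F η) := by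
      ext η
      rw [← neg_sub, inv_neg]; ring
    rw [this, circleIntegral.integral_const_mul]; ring
  rw [hneg, ← key]; ring

lemma exp_bd1 {x : ℝ} (h0 : 0 ≤ x) (h1 : x ≤ 1 / 2) : (1 - x)⁻¹ ≤ Real.exp (x + x ^ 2) := by
  have : 1 + (x + x ^ 2) + (x + x ^ 2) ^ 2 / 2 ≤ Real.exp (x + x ^ 2) :=
    Real.quadratic_le_exp_of_nonneg (by positivity)
  rw [inv_le_iff_one_le_mul₀ (by linarith)]
  nlinarith [mul_le_mul_of_nonneg_right this (by linarith : 0 ≤ 1 - x), pow_nonneg h0 2, pow_nonneg h0 3,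
    pow_nonneg h0 4, mul_nonneg (pow_nonneg h0 2) (by linarith : 0 ≤ 1/2 - x),
    mul_nonneg (pow_nonneg h0 3) (by linarith : 0 ≤ 1/2 - x), mul_nonneg (pow_nonneg h0 4) (by linarith : 0 ≤ 1/2 - x)]

lemma exp_bd2 {x : ℝ} (h0 : 0 ≤ x) : (1 + x)⁻¹ ≤ Real.exp (-x + x ^ 2) := by
  have : 1 + (-x + x ^ 2) ≤ Real.exp (-x + x ^ 2) := by
    linarith [Real.add_one_le_exp (-x + x ^ 2)]
  rw [inv_le_iff_one_le_mul₀ (by linarith)]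
  nlinarith [mul_le_mul_of_nonneg_right this (by linarith : 0 ≤ 1 + x), pow_nonneg h0 3]

lemma factor_lower {p c : ℝ} (hp : 0 ≤ p) {η : ℂ} (hη : ‖η‖ ≤ 1 + c) :
    1 - p * c ≤ ‖1 - (p : ℂ) * (η - 1)‖ := by
  have e : 1 - (p : ℂ) * (η - 1) = ((1 + p : ℝ) : ℂ) - p * η := by push_cast; ring
  rw [e]
  have h1 := norm_sub_norm_le ((1 + p : ℝ) : ℂ) (p * η)
  rw [norm_mul, Complex.norm_real, Complex.norm_real, Real.norm_of_nonneg hp,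
    Real.norm_of_nonneg (by linarith)] at h1
  nlinarith

lemma prod_upper {ι : Type*} (s : Finset ι) (p : ι → ℝ) (hp : ∀ k ∈ s, 0 ≤ p k) {P μ u A : ℝ}
    (hP : 0 < P) (hμ : ∀ k ∈ s, p k ≤ μ * P) (hu : 0 ≤ u) (huμ : u * μ ≤ 1 / 2)
    (hμ0 : 0 ≤ μ) (hA : ∑ k ∈ s, p k ≤ A) :
    (∏ k ∈ s, (1 - p k * (u / P)))⁻¹ ≤ Real.exp (u * (A / P) + u ^ 2 * μ * (A / P)) := by
  rw [← Finset.prod_inv_distrib]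
  have h1 : ∀ k ∈ s, p k * (u / P) ≤ u * μ := by
    intro k hk
    have := mul_le_mul_of_nonneg_right (hμ k hk) (by positivity : 0 ≤ u / P)
    calc _ ≤ _ := this
      _ = u * μ := by field_simp
  calc ∏ k ∈ s, (1 - p k * (u / P))⁻¹
      ≤ ∏ k ∈ s, Real.exp (p k * ((u + u ^ 2 * μ) / P)) := by
        apply Finset.prod_le_prod
        · intro k hk; have := h1 k hk; rw [inv_nonneg]; linarith
        · intro k hk
          have h0 : 0 ≤ p k * (u / P) := mul_nonneg (hp k hk) (by positivity)
          refine (exp_bd1 h0 ((h1 k hk).trans huμ)).trans (Real.exp_le_exp.2 ?_)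
          have := mul_le_mul_of_nonneg_left (h1 k hk) h0
          calc _ ≤ p k * (u / P) + p k * (u / P) * (u * μ) := by nlinarith
            _ = _ := by ring
    _ = Real.exp ((∑ k ∈ s, p k) * ((u + u ^ 2 * μ) / P)) := by
        rw [← Real.exp_sum, Finset.sum_mul]
    _ ≤ _ := by
        apply Real.exp_le_exp.2
        calc _ ≤ A * ((u + u ^ 2 * μ) / P) := mul_le_mul_of_nonneg_right hA (by positivity)
          _ = _ := by ring

lemma fin_bound {ι : Type*} (s : Finset ι) (p : ι → ℝ) (hp : ∀ k ∈ s, 0 ≤ p k) {P μ t : ℝ} (N : ℕ)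
    (hP : 0 < P) (hμ0 : 0 ≤ μ) (hμ : ∀ k ∈ s, p k ≤ μ * P) (ht : 1 < t) (htμ : t * μ ≤ 1 / 2)
    (hA : ∑ k ∈ s, p k ≤ N - P) :
    ‖(P : ℂ) * ((2 * Real.pi * Complex.I)⁻¹ * (∮ η in C(0, 1),
      (η ^ (N + 1) * ((1 - (P : ℂ) * (η - 1)) * ∏ k ∈ s, (1 - (p k : ℂ) * (η - 1))))⁻¹)) -
        ((Real.exp (-1) : ℝ) : ℂ)‖ ≤
      |Real.exp (-1 + μ * (N / P) - 1 / P + (N + 1) / P ^ 2) - Real.exp (-1)|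
      + |Real.exp (-1) - Real.exp ((∑ k ∈ s, p k) / P - (N + 1) / P)|
      + P / (t - 1) * Real.exp (-t + t ^ 2 * μ * (N / P) + N * (t / P) ^ 2) := by
  set w : ℝ := 1 + 1 / P with hw
  set R : ℝ := 1 + t / P with hR
  have hPi : 0 < 1 / P := by positivity
  have h1w : 1 < w := by linarith
  have hwR : w < R := by
    have : 1 / P < t / P := by gcongr
    linarith
  set F : ℂ → ℂ := fun η => (η ^ (N + 1) * ∏ k ∈ s, (1 - (p k : ℂ) * (η - 1)))⁻¹ with hFdef
  have hfac : ∀ k ∈ s, p k * (t / P) ≤ 1 / 2 := by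
    intro k hk
    calc p k * (t / P) ≤ μ * P * (t / P) := mul_le_mul_of_nonneg_right (hμ k hk) (by positivity)
      _ = t * μ := by field_simp
      _ ≤ _ := htμ
  have hne : ∀ η : ℂ, 1 ≤ ‖η‖ → ‖η‖ ≤ R →
      η ^ (N + 1) * ∏ k ∈ s, (1 - (p k : ℂ) * (η - 1)) ≠ 0 := by
    intro η h1 h2
    apply mul_ne_zero
    · apply pow_ne_zero; rintro rfl; simp at h1; linarith
    · rw [Finset.prod_ne_zero_iff]
      intro k hk h
      have := factor_lower (hp k hk) h2
      rw [h, norm_zero] at this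
      linarith [hfac k hk]
  have hres := residue_aux F w R h1w hwR (by
    intro η h1 h2
    exact DifferentiableAt.inv (by fun_prop) (hne η h1 h2))
  have hcongr : (P : ℂ) * (∮ η in C(0, 1),
      (η ^ (N + 1) * ((1 - (P : ℂ) * (η - 1)) * ∏ k ∈ s, (1 - (p k : ℂ) * (η - 1))))⁻¹) =
      ∮ η in C(0, 1), ((w : ℂ) - η)⁻¹ * F η := by
    rw [← circleIntegral.integral_const_mul]
    apply circleIntegral.integral_congr zero_le_one
    intro η hη
    have hPc : (P : ℂ) ≠ 0 := by exact_mod_cast hP.ne'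
    have : (1 - (P : ℂ) * (η - 1)) = P * ((w : ℂ) - η) := by
      rw [hw]; push_cast; field_simp; ring
    simp only [hFdef]
    rw [this]
    generalize (∏ k ∈ s, (1 - (p k : ℂ) * (η - 1))) = Q
    simp only [mul_inv]
    field_simp
  have hpi : (2 * Real.pi * Complex.I : ℂ) ≠ 0 := by simp [Real.pi_ne_zero, Complex.I_ne_zero]
  rw [mul_left_comm, hcongr, hres, mul_sub, ← mul_assoc, inv_mul_cancel₀ hpi, one_mul]
  -- remainder bound
  have hN0 : (0 : ℝ) ≤ N := Nat.cast_nonneg N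
  have hAN : ∑ k ∈ s, p k ≤ N - P := hA
  have hpowR : (R ^ N)⁻¹ ≤ Real.exp (-(N * (t / P)) + N * (t / P) ^ 2) := by
    rw [← inv_pow]
    calc (R⁻¹) ^ N ≤ (Real.exp (-(t / P) + (t / P) ^ 2)) ^ N := by
          apply pow_le_pow_left₀ (inv_nonneg.2 (by linarith))
          exact exp_bd2 (by positivity)
      _ = _ := by rw [← Real.exp_nat_mul]; congr 1; ring
  have hrem : ‖(2 * Real.pi * Complex.I : ℂ)⁻¹ * ∮ η in C(0, R), (η - w)⁻¹ * F η‖ ≤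
      P / (t - 1) * Real.exp (-t + t ^ 2 * μ * (N / P) + N * (t / P) ^ 2) := by
    have hB := circleIntegral.norm_two_pi_i_inv_smul_integral_le_of_norm_le_const
      (f := fun η : ℂ => (η - w)⁻¹ * F η) (c := 0) (R := R)
      (C := P / (t - 1) * ((R ^ (N + 1))⁻¹ * (∏ k ∈ s, (1 - p k * (t / P)))⁻¹)) (by linarith) (by
        intro η hη
        have hηR : ‖η‖ = R := by simpa using hη
        rw [norm_mul, norm_inv]
        simp only [hFdef]
        rw [norm_inv, norm_mul, norm_pow, hηR, mul_inv, norm_prod]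
        have hpos : 0 < ∏ k ∈ s, (1 - p k * (t / P)) :=
          Finset.prod_pos (fun k hk => by linarith [hfac k hk])
        have hRp : 0 < R := by linarith
        have h3 : (t - 1) / P ≤ ‖η - w‖ := by
          have h := norm_sub_norm_le η (w : ℂ)
          rw [hηR, Complex.norm_real, Real.norm_of_nonneg (by linarith)] at h
          calc (t - 1) / P = R - w := by rw [hR, hw]; ring
            _ ≤ _ := h
        have ht1 : 0 < (t - 1) / P := div_pos (by linarith) hP
        apply mul_le_mul
        · rw [← inv_div]
          exact inv_anti₀ ht1 h3
        · apply mul_le_mul_of_nonneg_left _ (by positivity)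
          apply inv_anti₀ hpos
          apply Finset.prod_le_prod
          · intro k hk; linarith [hfac k hk]
          · intro k hk; exact factor_lower (hp k hk) hηR.le
        · positivity
        · exact div_nonneg hP.le (by linarith))
    rw [smul_eq_mul] at hB
    refine hB.trans ?_
    have hRp : 0 < R := by linarith
    have ht1 : 0 ≤ P / (t - 1) := div_nonneg hP.le (by linarith)
    have hQ := prod_upper s p hp hP hμ (by linarith : 0 ≤ t) htμ hμ0 hA
    calc R * (P / (t - 1) * ((R ^ (N + 1))⁻¹ * (∏ k ∈ s, (1 - p k * (t / P)))⁻¹))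
        = P / (t - 1) * ((R ^ N)⁻¹ * (∏ k ∈ s, (1 - p k * (t / P)))⁻¹) := by
          rw [pow_succ]; field_simp
      _ ≤ P / (t - 1) * (Real.exp (-(N * (t / P)) + N * (t / P) ^ 2) *
            Real.exp (t * ((N - P) / P) + t ^ 2 * μ * ((N - P) / P))) := by
          apply mul_le_mul_of_nonneg_left _ ht1
          apply mul_le_mul hpowR hQ _ (Real.exp_pos _).le
          rw [inv_nonneg]
          exact Finset.prod_nonneg (fun k hk => by linarith [hfac k hk])
      _ ≤ _ := by
          apply mul_le_mul_of_nonneg_left _ ht1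
          rw [← Real.exp_add]
          apply Real.exp_le_exp.2
          have e : (N - P) / P = N / P - 1 := by field_simp
          rw [e]
          have : 0 ≤ t ^ 2 * μ := by positivity
          have e2 : (N : ℝ) * (t / P) = t * (N / P) := by ring
          nlinarith
  -- main term
  have hFw : F w = (((w ^ (N + 1))⁻¹ * (∏ k ∈ s, (1 - p k * (1 / P)))⁻¹ : ℝ) : ℂ) := by
    simp only [hFdef]
    have : ((w : ℂ) - 1) = ((1 / P : ℝ) : ℂ) := by rw [hw]; push_cast; ring
    rw [this, mul_inv]; push_cast; rfl
  have hfac1 : ∀ k ∈ s, 1 / 2 ≤ 1 - p k * (1 / P) := by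
    intro k hk
    have h1 := hfac k hk
    have : p k * (1 / P) ≤ p k * (t / P) := by
      apply mul_le_mul_of_nonneg_left _ (hp k hk); linarith
    linarith
  have hprodpos : 0 < ∏ k ∈ s, (1 - p k * (1 / P)) :=
    Finset.prod_pos (fun k hk => by linarith [hfac1 k hk])
  have hwpos : 0 < w := by linarith
  set f : ℝ := (w ^ (N + 1))⁻¹ * (∏ k ∈ s, (1 - p k * (1 / P)))⁻¹ with hf
  have hup : f ≤ Real.exp (-1 + μ * (N / P) - 1 / P + (N + 1) / P ^ 2) := by
    have hQ := prod_upper s p hp hP hμ (zero_le_one) (by nlinarith) hμ0 hA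
    have hpw : (w ^ (N + 1))⁻¹ ≤ Real.exp ((N + 1) * (-(1 / P) + (1 / P) ^ 2)) := by
      rw [← inv_pow]
      calc (w⁻¹) ^ (N + 1) ≤ (Real.exp (-(1 / P) + (1 / P) ^ 2)) ^ (N + 1) := by
            apply pow_le_pow_left₀ (inv_nonneg.2 (by linarith))
            exact exp_bd2 (by positivity)
        _ = _ := by rw [← Real.exp_nat_mul]; push_cast; rfl
    calc f ≤ _ := mul_le_mul hpw hQ (inv_nonneg.2 hprodpos.le) (Real.exp_pos _).le
      _ ≤ _ := by
          rw [← Real.exp_add]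
          apply Real.exp_le_exp.2
          have e : (N - P) / P = N / P - 1 := by field_simp
          rw [e]
          have e3 : ((N : ℝ) + 1) * (-(1 / P) + (1 / P) ^ 2) = -(N / P) - 1 / P + (N + 1) / P ^ 2 := by
            field_simp; ring
          rw [e3]
          nlinarith
  have hlow : Real.exp ((∑ k ∈ s, p k) / P - (N + 1) / P) ≤ f := by
    have hpw : Real.exp (-((N + 1) / P)) ≤ (w ^ (N + 1))⁻¹ := by
      rw [Real.exp_neg]
      apply inv_anti₀ (by positivity)
      calc w ^ (N + 1) ≤ (Real.exp (1 / P)) ^ (N + 1) := by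
            apply pow_le_pow_left₀ hwpos.le
            rw [hw]; linarith [Real.add_one_le_exp (1 / P)]
        _ = _ := by rw [← Real.exp_nat_mul]; push_cast; congr 1; ring
    have hQ : Real.exp ((∑ k ∈ s, p k) / P) ≤ (∏ k ∈ s, (1 - p k * (1 / P)))⁻¹ := by
      rw [← inv_inv (Real.exp _), ← Real.exp_neg]
      apply inv_anti₀ hprodpos
      calc ∏ k ∈ s, (1 - p k * (1 / P)) ≤ ∏ k ∈ s, Real.exp (-(p k * (1 / P))) := by
            apply Finset.prod_le_prod
            · intro k hk; linarith [hfac1 k hk]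
            · intro k hk; exact Real.one_sub_le_exp_neg _
        _ = _ := by rw [← Real.exp_sum, Finset.sum_neg_distrib, ← Finset.sum_mul]; congr 1; ring
    calc _ = Real.exp (-((N + 1) / P)) * Real.exp ((∑ k ∈ s, p k) / P) := by
          rw [← Real.exp_add]; congr 1; ring
      _ ≤ f := mul_le_mul hpw hQ (Real.exp_pos _).le (by positivity)
  have hmain : ‖F w - ((Real.exp (-1) : ℝ) : ℂ)‖ ≤
      |Real.exp (-1 + μ * (N / P) - 1 / P + (N + 1) / P ^ 2) - Real.exp (-1)|
      + |Real.exp (-1) - Real.exp ((∑ k ∈ s, p k) / P - (N + 1) / P)| := by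
    rw [hFw, ← Complex.ofReal_sub, Complex.norm_real, Real.norm_eq_abs, abs_le]
    constructor
    · have := le_abs_self (Real.exp (-1) - Real.exp ((∑ k ∈ s, p k) / P - (N + 1) / P))
      have h2 := abs_nonneg (Real.exp (-1 + μ * (N / P) - 1 / P + (N + 1) / P ^ 2) - Real.exp (-1))
      linarith
    · have := abs_nonneg (Real.exp (-1) - Real.exp ((∑ k ∈ s, p k) / P - (N + 1) / P))
      have h2 := le_abs_self (Real.exp (-1 + μ * (N / P) - 1 / P + (N + 1) / P ^ 2) - Real.exp (-1))
      linarith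
  calc _ = ‖(F w - ((Real.exp (-1) : ℝ) : ℂ)) -
        (2 * Real.pi * Complex.I : ℂ)⁻¹ * ∮ η in C(0, R), (η - w)⁻¹ * F η‖ := by congr 1; ring
    _ ≤ _ := (norm_sub_le _ _).trans (add_le_add hmain hrem)

lemma core_bound {ι : Type*} [Countable ι] [DecidableEq ι] (i₀ : ι) (p : ι → ℝ) (hp : ∀ k, 0 ≤ p k)
    (hs : Summable p) {P μ t : ℝ} (N : ℕ) (hpP : p i₀ = P) (hN : ∑' k, p k = N)
    (hP : 0 < P) (hμ0 : 0 ≤ μ) (hμ : ∀ k, k ≠ i₀ → p k ≤ μ * P) (ht : 1 < t) (htμ : t * μ ≤ 1 / 2) :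
    ‖(P : ℂ) * ((2 * Real.pi * Complex.I)⁻¹ * (∮ η in C(0, 1),
      (η ^ (N + 1) * ∏' k, (1 - (p k : ℂ) * (η - 1)))⁻¹)) - ((Real.exp (-1) : ℝ) : ℂ)‖ ≤
      |Real.exp (-1 + μ * (N / P) - 1 / P + (N + 1) / P ^ 2) - Real.exp (-1)|
      + |Real.exp (-1) - Real.exp (-1 - 1 / P)|
      + P / (t - 1) * Real.exp (-t + t ^ 2 * μ * (N / P) + N * (t / P) ^ 2) := by
  have hfl : ∀ k, ∀ η : ℂ, ‖η‖ = 1 → 1 ≤ ‖1 - (p k : ℂ) * (η - 1)‖ := by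
    intro k η hη
    have := factor_lower (hp k) (c := 0) (η := η) (by linarith)
    linarith
  have hprodl : ∀ (s : Finset ι) (η : ℂ), ‖η‖ = 1 → 1 ≤ ‖∏ k ∈ s, (1 - (p k : ℂ) * (η - 1))‖ := by
    intro s η hη
    rw [norm_prod]
    calc (1 : ℝ) = ∏ k ∈ s, 1 := by simp
      _ ≤ _ := Finset.prod_le_prod (fun _ _ => zero_le_one) (fun k _ => hfl k η hη)
  have hconv : Tendsto (fun s : Finset ι => ∮ η in C(0, 1),
      (η ^ (N + 1) * ∏ k ∈ s, (1 - (p k : ℂ) * (η - 1)))⁻¹) atTop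
      (nhds (∮ η in C(0, 1), (η ^ (N + 1) * ∏' k, (1 - (p k : ℂ) * (η - 1)))⁻¹)) := by
    unfold circleIntegral
    apply intervalIntegral.tendsto_integral_filter_of_dominated_convergence (fun _ => 1)
    · refine Eventually.of_forall fun s => ?_
      apply Continuous.aestronglyMeasurable
      simp only [deriv_circleMap]
      refine Continuous.fun_smul (by fun_prop) ?_
      refine Continuous.inv₀ (by fun_prop) ?_
      intro θ h
      have hc : ‖circleMap 0 1 θ‖ = 1 := by simp
      rcases mul_eq_zero.1 h with h | h
      · have := pow_eq_zero_iff (by omega) |>.1 h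
        rw [this] at hc; simp at hc
      · have := hprodl s _ hc
        rw [h] at this; simp at this; linarith
    · refine Eventually.of_forall fun s => Eventually.of_forall fun θ _ => ?_
      have hc : ‖circleMap 0 1 θ‖ = 1 := by simp
      rw [norm_smul, norm_inv, norm_mul, norm_pow, hc]
      have := inv_le_one_of_one_le₀ (hprodl s _ hc)
      simpa [deriv_circleMap] using this
    · exact intervalIntegrable_const
    · refine Eventually.of_forall fun θ _ => ?_
      have hc : ‖circleMap 0 1 θ‖ = 1 := by simp
      apply Tendsto.const_smul
      have hm : Multipliable fun k => (1 - (p k : ℂ) * (circleMap 0 1 θ - 1)) := by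
        have hsum : Summable fun k => -((p k : ℂ) * (circleMap 0 1 θ - 1)) :=
          ((Complex.summable_ofReal.2 hs).mul_right _).neg
        simpa [sub_eq_add_neg] using Complex.multipliable_one_add_of_summable hsum
      have ht := hm.hasProd
      have hn : 1 ≤ ‖∏' k, (1 - (p k : ℂ) * (circleMap 0 1 θ - 1))‖ :=
        ge_of_tendsto ht.norm (Eventually.of_forall fun s => by
          have := hprodl s _ hc
          rwa [norm_prod] at this)
      apply Tendsto.inv₀
      · exact Tendsto.const_mul _ ht
      · apply mul_ne_zero
        · apply pow_ne_zero
          intro h; rw [h] at hc; simp at hc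
        · intro h; rw [h] at hn; simp at hn; linarith
  have hsumt : Tendsto (fun s : Finset ι => ∑ k ∈ s, p k) atTop (nhds (N : ℝ)) := by
    rw [← hN]; exact hs.hasSum
  refine le_of_tendsto_of_tendsto (b := (atTop : Filter (Finset ι)))
    (f := fun s => ‖(P : ℂ) * ((2 * Real.pi * Complex.I)⁻¹ * (∮ η in C(0, 1),
      (η ^ (N + 1) * ∏ k ∈ s, (1 - (p k : ℂ) * (η - 1)))⁻¹)) - ((Real.exp (-1) : ℝ) : ℂ)‖)
    (g := fun s => |Real.exp (-1 + μ * (N / P) - 1 / P + (N + 1) / P ^ 2) - Real.exp (-1)|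
      + |Real.exp (-1) - Real.exp ((∑ k ∈ s, p k - P) / P - (N + 1) / P)|
      + P / (t - 1) * Real.exp (-t + t ^ 2 * μ * (N / P) + N * (t / P) ^ 2))
    ?_ ?_ ?_
  · exact (((hconv.const_mul _).const_mul _).sub_const _).norm
  · apply Tendsto.add_const
    apply Tendsto.const_add
    apply Tendsto.abs
    apply Tendsto.const_sub
    have e : -1 - 1 / P = ((N : ℝ) - P) / P - (N + 1) / P := by field_simp; ring
    rw [e]
    exact (Real.continuous_exp.tendsto _).comp (((hsumt.sub_const _).div_const _).sub_const _)
  · filter_upwards [eventually_ge_atTop {i₀}] with s hsi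
    have hi : i₀ ∈ s := by simpa using hsi
    have hle : ∑ k ∈ s, p k ≤ N := by rw [← hN]; exact hs.sum_le_tsum s (fun k _ => hp k)
    have hsplit : ∑ k ∈ s.erase i₀, p k = ∑ k ∈ s, p k - P := by
      rw [← Finset.add_sum_erase s p hi, hpP]; ring
    have h := fin_bound (s.erase i₀) p (fun k _ => hp k) (P := P) (μ := μ) (t := t) N hP hμ0
      (fun k hk => hμ k (Finset.ne_of_mem_erase hk)) ht htμ (by rw [hsplit]; linarith)
    rw [hsplit] at h
    have e : ∀ η : ℂ, (1 - (P : ℂ) * (η - 1)) * ∏ k ∈ s.erase i₀, (1 - (p k : ℂ) * (η - 1)) =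
        ∏ k ∈ s, (1 - (p k : ℂ) * (η - 1)) := by
      intro η
      rw [← Finset.mul_prod_erase s _ hi, hpP]
    simp_rw [e] at h
    exact h

def hB (β s : ℝ) : ℝ := Real.exp (-β * s) / (1 - Real.exp (-β * s))

lemma hB_eq {β s : ℝ} : hB β s = (Real.exp (β * s) - 1)⁻¹ := by
  unfold hB
  rw [neg_mul, Real.exp_neg]
  have := Real.exp_pos (β * s)
  by_cases h : Real.exp (β * s) = 1
  · rw [h]; simp
  · have h1 : Real.exp (β * s) - 1 ≠ 0 := sub_ne_zero.2 h
    have h2 : 1 - (Real.exp (β * s))⁻¹ ≠ 0 := by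
      rw [sub_ne_zero]; intro h3; apply h; rw [← inv_inv (Real.exp (β * s)), ← h3]; simp
    field_simp

lemma hB_zero (β : ℝ) : hB β 0 = 0 := by simp [hB_eq]

lemma hB_nonneg {β s : ℝ} (hβ : 0 < β) (hs : 0 ≤ s) : 0 ≤ hB β s := by
  rw [hB_eq, inv_nonneg]
  have := Real.add_one_le_exp (β * s)
  have : 0 ≤ β * s := by positivity
  linarith

lemma hB_anti {β s t : ℝ} (hβ : 0 < β) (hs : 0 < s) (hst : s ≤ t) : hB β t ≤ hB β s := by
  rw [hB_eq, hB_eq]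
  have := Real.add_one_le_exp (β * s)
  have : 0 < β * s := by positivity
  apply inv_anti₀ (by linarith)
  gcongr

lemma hB_le_inv {β s : ℝ} (hβ : 0 < β) (hs : 0 < s) : hB β s ≤ (β * s)⁻¹ := by
  rw [hB_eq]
  have := Real.add_one_le_exp (β * s)
  have : 0 < β * s := by positivity
  apply inv_anti₀ (by linarith)
  linarith

lemma hB_le_exp {β s : ℝ} (hβ : 0 < β) (hs : 0 < s) :
    hB β s ≤ (β * s)⁻¹ * Real.exp (-(β / 2) * s) := by
  rw [hB_eq]
  have h0 : 0 < β * s := by positivity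
  have e : (β * s)⁻¹ * Real.exp (-(β / 2) * s) = (β * s * Real.exp (β * s / 2))⁻¹ := by
    rw [mul_inv (β * s), ← Real.exp_neg]; congr 2; ring
  rw [e]
  apply inv_anti₀ (by positivity)
  have h1 : β * s / 2 ≤ Real.sinh (β * s / 2) := Real.self_le_sinh_iff.2 (by positivity)
  rw [Real.sinh_eq] at h1
  have h2 : Real.exp (β * s) = Real.exp (β * s / 2) * Real.exp (β * s / 2) := by
    rw [← Real.exp_add]; congr 1; ring
  have h3 : Real.exp (-(β * s / 2)) * Real.exp (β * s / 2) = 1 := by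
    rw [← Real.exp_add]; simp
  nlinarith [Real.exp_pos (β * s / 2)]

lemma measurable_hB (β : ℝ) : Measurable (hB β) := by
  unfold hB; fun_prop

lemma hB_continuousAt {β s : ℝ} (hβ : 0 < β) (hs : 0 < s) : ContinuousAt (hB β) s := by
  unfold hB
  apply ContinuousAt.div (by fun_prop) (by fun_prop)
  have : Real.exp (-β * s) < 1 := by
    rw [Real.exp_lt_one_iff]; nlinarith
  linarith

lemma a1crit_eq (d : ℕ) (β : ℝ) (p : EuclideanSpace ℝ (Fin d)) :
    a1crit d β p = hB β (∑ i, (p i) ^ 2) := by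
  unfold a1crit hB
  rw [EuclideanSpace.real_norm_sq_eq]

lemma a1crit_integrable (d : ℕ) (hd : 2 < d) (β : ℝ) (hβ : 0 < β) :
    Integrable (a1crit d β) := by
  have : Nonempty (Fin d) := ⟨⟨0, by omega⟩⟩
  have h := integrable_fun_norm_addHaar (E := EuclideanSpace ℝ (Fin d)) volume
    (f := fun r : ℝ => hB β (r ^ 2))
  have e : (fun x : EuclideanSpace ℝ (Fin d) => hB β (‖x‖ ^ 2)) = a1crit d β := by
    ext x; rfl
  rw [e] at h
  rw [h]
  have hg := ((integrable_rpow_mul_exp_neg_mul_sq (b := β / 2) (by positivity)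
    (s := (d : ℝ) - 3) (by
      have : (3 : ℝ) ≤ d := by exact_mod_cast hd
      linarith)).const_mul β⁻¹).integrableOn (s := Set.Ioi 0)
  refine Integrable.mono' hg ?_ ?_
  · apply Measurable.aestronglyMeasurable
    have := measurable_hB β
    simp only [smul_eq_mul]
    fun_prop
  · refine (ae_restrict_iff' measurableSet_Ioi).2 (Eventually.of_forall fun y hy => ?_)
    have hy0 : (0 : ℝ) < y := hy
    simp only [finrank_euclideanSpace, Fintype.card_fin, smul_eq_mul]
    rw [Real.norm_of_nonneg (mul_nonneg (by positivity) (hB_nonneg hβ (by positivity)))]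
    have h1 := hB_le_exp hβ (s := y ^ 2) (by positivity)
    obtain ⟨m, rfl⟩ : ∃ m, d = m + 3 := ⟨d - 3, by omega⟩
    have e1 : ((m + 3 : ℕ) : ℝ) - 3 = (m : ℝ) := by push_cast; ring
    rw [e1, Real.rpow_natCast]
    calc y ^ (m + 3 - 1) * hB β (y ^ 2)
        ≤ y ^ (m + 3 - 1) * ((β * y ^ 2)⁻¹ * Real.exp (-(β / 2) * y ^ 2)) := by gcongr
      _ = _ := by
        have : m + 3 - 1 = m + 2 := by omega
        rw [this, pow_add]
        field_simp

lemma A_int (d : ℕ) (hd : 2 < d) (β : ℝ) (hβ : 0 < β) :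
    Integrable (fun x : Fin d → ℝ => hB β (∑ i, (x i) ^ 2)) := by
  have h := a1crit_integrable d hd β hβ
  have hmp := PiLp.volume_preserving_ofLp (Fin d)
  rw [← hmp.integrable_comp_emb (MeasurableEquiv.toLp 2 (Fin d → ℝ)).symm.measurableEmbedding]
  have e : ((fun x : Fin d → ℝ => hB β (∑ i, (x i) ^ 2)) ∘ WithLp.ofLp) = a1crit d β := by
    ext p
    rw [a1crit_eq]; rfl
  rw [e]
  exact h

lemma A_integral (d : ℕ) (β : ℝ) :
    ∫ x : Fin d → ℝ, hB β (∑ i, (x i) ^ 2) = ∫ p : EuclideanSpace ℝ (Fin d), a1crit d β p := by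
  have hmp := PiLp.volume_preserving_ofLp (Fin d)
  rw [← hmp.integral_comp (MeasurableEquiv.toLp 2 (Fin d → ℝ)).symm.measurableEmbedding]
  congr 1
  ext p
  rw [a1crit_eq]

lemma map_floor (d : ℕ) : Measure.map (fun (x : Fin d → ℝ) i => ⌊x i⌋) volume =
    (Measure.count : Measure (Fin d → ℤ)) := by
  have hm : Measurable (fun (x : Fin d → ℝ) i => ⌊x i⌋) :=
    measurable_pi_lambda _ fun i => Int.measurable_floor.comp (measurable_pi_apply i)
  apply Measure.ext_of_singleton
  intro k
  rw [Measure.map_apply hm (measurableSet_singleton _), Measure.count_singleton]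
  have : (fun (x : Fin d → ℝ) i => ⌊x i⌋) ⁻¹' {k} =
      Set.pi Set.univ fun i => Set.Ico (k i : ℝ) ((k i : ℝ) + 1) := by
    ext x
    simp only [Set.mem_preimage, Set.mem_singleton_iff, Set.mem_pi, Set.mem_univ, true_imp_iff,
      Set.mem_Ico, funext_iff, Int.floor_eq_iff]
  rw [this, Real.volume_pi_Ico]
  simp

lemma floor_sum (d : ℕ) (G : (Fin d → ℤ) → ℝ) (c : ℝ) (hc : 0 < c)
    (hi : Integrable (fun x : Fin d → ℝ => G (fun i => ⌊c * x i⌋))) :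
    Summable G ∧ ∑' k, G k = c ^ d * ∫ x : Fin d → ℝ, G (fun i => ⌊c * x i⌋) := by
  have hm : Measurable (fun (x : Fin d → ℝ) i => ⌊x i⌋) :=
    measurable_pi_lambda _ fun i => Int.measurable_floor.comp (measurable_pi_apply i)
  have h1 : Integrable (fun x : Fin d → ℝ => G (fun i => ⌊x i⌋)) := by
    rw [← integrable_comp_smul_iff volume _ hc.ne']
    exact hi
  have hG : Measurable G := measurable_of_countable _
  have h2 : Integrable G (Measure.count : Measure (Fin d → ℤ)) := by
    rw [← map_floor d, integrable_map_measure hG.aestronglyMeasurable hm.aemeasurable]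
    exact h1
  refine ⟨(integrable_count_iff.1 h2).of_norm, ?_⟩
  have h3 := integral_countable h2
  have h4 : ∑' k, G k = ∫ x : Fin d → ℝ, G (fun i => ⌊x i⌋) := by
    rw [← integral_map hm.aemeasurable hG.aestronglyMeasurable, map_floor, h3]
    simp [Measure.real]
  have h5 := Measure.integral_comp_smul volume (fun x : Fin d → ℝ => G (fun i => ⌊x i⌋)) c
  simp only [Pi.smul_apply, smul_eq_mul, Module.finrank_fin_fun] at h5
  rw [h5, h4, abs_of_pos (by positivity), ← mul_assoc, mul_inv_cancel₀ (by positivity), one_mul]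

def Gk (d : ℕ) (β L : ℝ) (k : Fin d → ℤ) : ℝ :=
  hB β (∑ i, (2 * Real.pi * (k i : ℝ) / L) ^ 2)

lemma sum_floor_ge (d : ℕ) (k : Fin d → ℤ) (hk : k ≠ 0) : 1 ≤ ∑ i, (k i : ℝ) ^ 2 := by
  obtain ⟨j, hj⟩ : ∃ j, k j ≠ 0 := by
    by_contra h; push Not at h; exact hk (funext h)
  have h1 : (1 : ℝ) ≤ (k j : ℝ) ^ 2 := by
    have : (1 : ℤ) ≤ (k j) ^ 2 := by
      have := sq_pos_of_ne_zero hj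
      linarith
    exact_mod_cast this
  exact h1.trans (Finset.single_le_sum (f := fun i => (k i : ℝ) ^ 2) (fun i _ => sq_nonneg _) (Finset.mem_univ j))

lemma Gk_bound (d : ℕ) (β L : ℝ) (hβ : 0 < β) (hL : 0 < L) (x : Fin d → ℝ) :
    Gk d β L (fun i => ⌊L / (2 * Real.pi) * x i⌋) ≤
      hB (β / (2 + 2 * d)) (∑ i, (x i) ^ 2) := by
  set k : Fin d → ℤ := fun i => ⌊L / (2 * Real.pi) * x i⌋ with hkdef
  have hb : 0 ≤ hB (β / (2 + 2 * d)) (∑ i, (x i) ^ 2) :=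
    hB_nonneg (by positivity) (Finset.sum_nonneg fun i _ => sq_nonneg _)
  by_cases hk : k = 0
  · rw [hk]; unfold Gk; simpa [hB_zero] using hb
  have hx : x ≠ 0 := by
    rintro rfl; apply hk; ext i; simp [hkdef]
  have hxs : 0 < ∑ i, (x i) ^ 2 := by
    obtain ⟨j, hj⟩ : ∃ j, x j ≠ 0 := by
      by_contra h; push Not at h; exact hx (funext h)
    exact Finset.sum_pos' (fun i _ => sq_nonneg _) ⟨j, Finset.mem_univ _, by positivity⟩
  have hks := sum_floor_ge d k hk
  have e : hB (β / (2 + 2 * d)) (∑ i, (x i) ^ 2) = hB β ((∑ i, (x i) ^ 2) / (2 + 2 * d)) := by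
    have : -(β / (2 + 2 * d)) * (∑ i, (x i) ^ 2) = -β * ((∑ i, (x i) ^ 2) / (2 + 2 * d)) := by ring
    unfold hB; rw [this]
  rw [e]
  unfold Gk
  apply hB_anti hβ (by positivity)
  rw [div_le_iff₀ (by positivity)]
  have hpi := Real.pi_pos
  set c : ℝ := 2 * Real.pi / L with hc
  have hcp : 0 < c := by positivity
  have hxi : ∀ i, (x i) ^ 2 ≤ c ^ 2 * (2 * (k i : ℝ) ^ 2 + 2) := by
    intro i
    have h1 := Int.floor_le (L / (2 * Real.pi) * x i)
    have h2 := Int.lt_floor_add_one (L / (2 * Real.pi) * x i)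
    have h3 : x i = c * (L / (2 * Real.pi) * x i) := by rw [hc]; field_simp
    set y := L / (2 * Real.pi) * x i
    have hki : (k i : ℝ) = (⌊y⌋ : ℝ) := rfl
    rw [h3, mul_pow, hki]
    apply mul_le_mul_of_nonneg_left _ (by positivity)
    nlinarith [sq_nonneg ((⌊y⌋ : ℝ) - (y - ⌊y⌋))]
  calc ∑ i, (x i) ^ 2 ≤ ∑ i, c ^ 2 * (2 * (k i : ℝ) ^ 2 + 2) := Finset.sum_le_sum fun i _ => hxi i
    _ = c ^ 2 * (2 * (∑ i, (k i : ℝ) ^ 2) + 2 * d) := by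
      rw [← Finset.mul_sum, Finset.sum_add_distrib, ← Finset.mul_sum, Finset.sum_const, Finset.card_univ,
        Fintype.card_fin, nsmul_eq_mul]; ring
    _ ≤ c ^ 2 * ((∑ i, (k i : ℝ) ^ 2) * (2 + 2 * d)) := by
      apply mul_le_mul_of_nonneg_left _ (by positivity)
      have : (0 : ℝ) ≤ d := by positivity
      nlinarith
    _ = _ := by
      rw [← mul_assoc, Finset.mul_sum]
      congr 1
      apply Finset.sum_congr rfl
      intro i _
      rw [hc]; ring

lemma Gk_nonneg (d : ℕ) (β L : ℝ) (hβ : 0 < β) (k) : 0 ≤ Gk d β L k :=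
  hB_nonneg hβ (Finset.sum_nonneg fun i _ => sq_nonneg _)

lemma Gk_meas (d : ℕ) (β L : ℝ) :
    Measurable (fun x : Fin d → ℝ => Gk d β L (fun i => ⌊L / (2 * Real.pi) * x i⌋)) := by
  have hm : Measurable (fun (x : Fin d → ℝ) i => ⌊L / (2 * Real.pi) * x i⌋) :=
    measurable_pi_lambda _ fun i => Int.measurable_floor.comp ((measurable_pi_apply i).const_mul _)
  exact (measurable_of_countable (Gk d β L)).comp hm

lemma Gk_integrable (d : ℕ) (hd : 2 < d) (β L : ℝ) (hβ : 0 < β) (hL : 0 < L) :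
    Integrable (fun x : Fin d → ℝ => Gk d β L (fun i => ⌊L / (2 * Real.pi) * x i⌋)) := by
  refine (A_int d hd (β / (2 + 2 * d)) (by positivity)).mono' (Gk_meas d β L).aestronglyMeasurable ?_
  refine Eventually.of_forall fun x => ?_
  rw [Real.norm_of_nonneg (Gk_nonneg d β L hβ _)]
  exact Gk_bound d β L hβ hL x

lemma riemann_limit (d : ℕ) (hd : 2 < d) (β : ℝ) (hβ : 0 < β)
    (L : ℕ → ℝ) (hLpos : ∀ n, 0 < L n) (hL : Tendsto L atTop atTop) :
    Tendsto (fun n => (∑' k, Gk d β (L n) k) / L n ^ d) atTop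
      (nhds ((∫ p : EuclideanSpace ℝ (Fin d), a1crit d β p) / (2 * Real.pi) ^ d)) := by
  have hpi := Real.pi_pos
  have e : ∀ n, (∑' k, Gk d β (L n) k) / L n ^ d =
      (∫ x : Fin d → ℝ, Gk d β (L n) (fun i => ⌊L n / (2 * Real.pi) * x i⌋)) / (2 * Real.pi) ^ d := by
    intro n
    have hLn := hLpos n
    rw [(floor_sum d (Gk d β (L n)) (L n / (2 * Real.pi)) (by positivity)
      (Gk_integrable d hd β (L n) hβ (hLpos n))).2, div_pow]
    field_simp
  simp_rw [e]
  apply Tendsto.div_const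
  rw [← A_integral]
  apply tendsto_integral_of_dominated_convergence
    (fun x : Fin d → ℝ => hB (β / (2 + 2 * d)) (∑ i, (x i) ^ 2))
  · exact fun n => (Gk_meas d β (L n)).aestronglyMeasurable
  · exact A_int d hd _ (by positivity)
  · intro n
    refine Eventually.of_forall fun x => ?_
    rw [Real.norm_of_nonneg (Gk_nonneg d β (L n) hβ _)]
    exact Gk_bound d β (L n) hβ (hLpos n) x
  · refine Eventually.of_forall fun x => ?_
    by_cases hx : x = 0
    · subst hx
      simp [Gk, hB_zero]
    have hxs : 0 < ∑ i, (x i) ^ 2 := by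
      obtain ⟨j, hj⟩ : ∃ j, x j ≠ 0 := by
        by_contra h; push Not at h; exact hx (funext h)
      exact Finset.sum_pos' (fun i _ => sq_nonneg _) ⟨j, Finset.mem_univ _, by positivity⟩
    unfold Gk
    refine (hB_continuousAt hβ hxs).tendsto.comp ?_
    apply tendsto_finsetSum
    intro i _
    apply Tendsto.pow
    have h0 : Tendsto (fun n => 2 * Real.pi / L n) atTop (nhds 0) := hL.const_div_atTop _
    have hlow : Tendsto (fun n => x i - 2 * Real.pi / L n) atTop (nhds (x i)) := by
      simpa using h0.const_sub (x i)
    refine tendsto_of_tendsto_of_tendsto_of_le_of_le hlow tendsto_const_nhds ?_ ?_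
    · intro n
      have hLn := hLpos n
      have h2 := Int.lt_floor_add_one (L n / (2 * Real.pi) * x i)
      have h3 : x i = 2 * Real.pi / L n * (L n / (2 * Real.pi) * x i) := by field_simp
      show x i - 2 * Real.pi / L n ≤ 2 * Real.pi * (⌊L n / (2 * Real.pi) * x i⌋ : ℝ) / L n
      have hcp : 0 < 2 * Real.pi / L n := by positivity
      have := mul_le_mul_of_nonneg_left h2.le hcp.le
      rw [← h3] at this
      calc _ ≤ 2 * Real.pi / L n * ((⌊L n / (2 * Real.pi) * x i⌋ : ℝ) + 1) - 2 * Real.pi / L n := by linarith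
        _ = _ := by ring
    · intro n
      have hLn := hLpos n
      have h2 := Int.floor_le (L n / (2 * Real.pi) * x i)
      have h3 : x i = 2 * Real.pi / L n * (L n / (2 * Real.pi) * x i) := by field_simp
      show 2 * Real.pi * (⌊L n / (2 * Real.pi) * x i⌋ : ℝ) / L n ≤ x i
      have hcp : 0 < 2 * Real.pi / L n := by positivity
      have := mul_le_mul_of_nonneg_left h2 hcp.le
      rw [← h3] at this
      calc _ = 2 * Real.pi / L n * (⌊L n / (2 * Real.pi) * x i⌋ : ℝ) := by ring
        _ ≤ _ := this

lemma gk_zero (d : ℕ) (β L : ℝ) : gk d β L 0 = 1 := by simp [gk]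

lemma gk_pos (d : ℕ) (β L : ℝ) (k) : 0 < gk d β L k := Real.exp_pos _

lemma gk_le_one (d : ℕ) (β L : ℝ) (hβ : 0 < β) (k) : gk d β L k ≤ 1 := by
  unfold gk
  rw [Real.exp_le_one_iff]
  have : 0 ≤ ∑ i, (2 * Real.pi * (k i : ℝ) / L) ^ 2 := Finset.sum_nonneg fun i _ => sq_nonneg _
  nlinarith

lemma pk_nonneg (d : ℕ) (β L z : ℝ) (hβ : 0 < β) (hz : z ∈ Set.Ioo (0 : ℝ) 1) (k) :
    0 ≤ pk d β L z k := by
  have h1 := gk_le_one d β L hβ k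
  have h0 := gk_pos d β L k
  unfold pk
  apply div_nonneg (mul_nonneg hz.1.le h0.le)
  nlinarith [hz.1, hz.2]

lemma sum_scaled (d : ℕ) (L : ℝ) (k : Fin d → ℤ) :
    ∑ i, (2 * Real.pi * (k i : ℝ) / L) ^ 2 = (2 * Real.pi / L) ^ 2 * ∑ i, (k i : ℝ) ^ 2 := by
  rw [Finset.mul_sum]
  exact Finset.sum_congr rfl fun i _ => by ring

lemma Gk_le (d : ℕ) (β L : ℝ) (hβ : 0 < β) (hL : 0 < L) (k) (hk : k ≠ 0) :
    Gk d β L k ≤ L ^ 2 / (4 * Real.pi ^ 2 * β) := by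
  have hpi := Real.pi_pos
  have hs := sum_floor_ge d k hk
  have h1 : (2 * Real.pi / L) ^ 2 ≤ ∑ i, (2 * Real.pi * (k i : ℝ) / L) ^ 2 := by
    rw [sum_scaled]
    exact le_mul_of_one_le_right (by positivity) hs
  calc Gk d β L k ≤ hB β ((2 * Real.pi / L) ^ 2) := hB_anti hβ (by positivity) h1
    _ ≤ (β * (2 * Real.pi / L) ^ 2)⁻¹ := hB_le_inv hβ (by positivity)
    _ = _ := by field_simp; norm_num

lemma pk_le_Gk (d : ℕ) (β L z : ℝ) (hβ : 0 < β) (hL : 0 < L) (hz : z ∈ Set.Ioo (0 : ℝ) 1)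
    (k : Fin d → ℤ) (hk : k ≠ 0) : pk d β L z k ≤ Gk d β L k := by
  have hpi := Real.pi_pos
  have hs := sum_floor_ge d k hk
  have h0 := gk_pos d β L k
  have h1 : gk d β L k < 1 := by
    unfold gk
    rw [Real.exp_lt_one_iff, sum_scaled]
    have : 0 < (2 * Real.pi / L) ^ 2 * ∑ i, (k i : ℝ) ^ 2 := by positivity
    nlinarith
  show _ ≤ gk d β L k / (1 - gk d β L k)
  unfold pk
  have h2 : z * gk d β L k ≤ gk d β L k := by nlinarith [hz.2]
  exact div_le_div₀ h0.le h2 (by linarith) (by linarith)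

lemma pk_zero (d : ℕ) (β L z : ℝ) : pk d β L z 0 = z / (1 - z) := by
  simp [pk, gk_zero]

lemma N_le (d : ℕ) (hd : 2 < d) (β L z : ℝ) (hβ : 0 < β) (hL : 0 < L) (hz : z ∈ Set.Ioo (0 : ℝ) 1)
    (hs : Summable (pk d β L z)) :
    ∑' k, pk d β L z k ≤ z / (1 - z) + ∑' k, Gk d β L k := by
  have hpi := Real.pi_pos
  have hG := (floor_sum d (Gk d β L) (L / (2 * Real.pi)) (by positivity)
      (Gk_integrable d hd β L hβ hL)).1
  have hle : ∀ k, pk d β L z k ≤ (if k = 0 then z / (1 - z) else 0) + Gk d β L k := by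
    intro k
    by_cases hk : k = 0
    · rw [if_pos hk, hk, pk_zero]
      linarith [Gk_nonneg d β L hβ 0]
    · rw [if_neg hk, zero_add]; exact pk_le_Gk d β L z hβ hL hz k hk
  have h1 : HasSum (fun k : Fin d → ℤ => if k = 0 then z / (1 - z) else 0) (z / (1 - z)) :=
    hasSum_ite_eq 0 _
  exact hasSum_le hle hs.hasSum (h1.add hG.hasSum)

/-- Lemma 7 (first equation): in the supercritical thermodynamic limit,
`p₀^{(N)} ∮_{S₁(0)} Det[1 - z₀G_L(1-z₀G_L)^{-1}(η-1)]^{-1} dη/(2πi η^{N+1}) → 1/e`,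
the determinant being `Π_{k∈ℤ^d} (1 - p_k^{(N)}(η-1))` with `p₀^{(N)} = z₀/(1-z₀)`. -/
theorem contour_integral_limit_BEC (d : ℕ) (hd : 2 < d) (β : ℝ) (hβ : 0 < β)
    (L : ℕ → ℝ) (hLpos : ∀ n, 0 < L n) (hL : Tendsto L atTop atTop)
    (N : ℕ → ℕ) (hN : ∀ n, 1 ≤ N n) (ρ : ℝ)
    (hρsup : (∫ p : EuclideanSpace ℝ (Fin d), a1crit d β p) / (2 * Real.pi) ^ d < ρ)
    (hdens : Tendsto (fun n => (N n : ℝ) / L n ^ d) atTop (nhds ρ))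
    (z : ℕ → ℝ)
    (hz : ∀ n, z n ∈ Set.Ioo (0 : ℝ) 1 ∧
      (∑' k : Fin d → ℤ, pk d β (L n) (z n) k) = N n) :
    Tendsto
      (fun n => ((z n / (1 - z n) : ℝ) : ℂ) * ((2 * Real.pi * Complex.I)⁻¹ *
        (∮ η in C(0, 1),
          (η ^ (N n + 1) *
            ∏' k : Fin d → ℤ, (1 - (pk d β (L n) (z n) k : ℂ) * (η - 1)))⁻¹)))
      atTop (nhds ((Real.exp 1)⁻¹ : ℂ)) := by
  have hpi := Real.pi_pos
  set ρc := (∫ p : EuclideanSpace ℝ (Fin d), a1crit d β p) / (2 * Real.pi) ^ d with hρc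
  set c : ℝ := (ρ - ρc) / 2 with hc
  have hc0 : 0 < c := by rw [hc]; linarith
  set P : ℕ → ℝ := fun n => z n / (1 - z n) with hPdef
  have hsum : ∀ n, Summable (pk d β (L n) (z n)) := by
    intro n
    by_contra h
    have h1 := (hz n).2
    rw [tsum_eq_zero_of_not_summable h] at h1
    have h2 := hN n
    have : N n = 0 := by exact_mod_cast h1.symm
    omega
  have hP0 : ∀ n, 0 < P n := fun n => div_pos (hz n).1.1 (by linarith [(hz n).1.2])
  have hPN : ∀ n, P n ≤ N n := by
    intro n
    rw [← (hz n).2]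
    have := (hsum n).le_tsum 0 (fun k _ => pk_nonneg d β (L n) (z n) hβ (hz n).1 k)
    rwa [pk_zero] at this
  have hPlow : ∀ᶠ n in atTop, c * L n ^ d ≤ P n := by
    have h1 := hdens.sub (riemann_limit d hd β hβ L hLpos hL)
    have h2 : c < ρ - ρc := by rw [hc]; linarith
    filter_upwards [h1.eventually (lt_mem_nhds h2)] with n hn
    have hLd : 0 < L n ^ d := pow_pos (hLpos n) d
    rw [← sub_div, lt_div_iff₀ hLd] at hn
    have := N_le d hd β (L n) (z n) hβ (hLpos n) (hz n).1 (hsum n)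
    rw [(hz n).2] at this
    have e : P n = z n / (1 - z n) := rfl
    linarith
  set C : ℝ := ρ + 1 with hC
  have hNup : ∀ᶠ n in atTop, (N n : ℝ) ≤ C * L n ^ d := by
    filter_upwards [hdens.eventually (gt_mem_nhds (by linarith : ρ < C))] with n hn
    have hLd : 0 < L n ^ d := pow_pos (hLpos n) d
    rw [div_lt_iff₀ hLd] at hn
    exact hn.le
  have hL4 := hL.eventually_ge_atTop 4
  set K : ℝ := C / c with hK
  set M : ℝ := 1 / (4 * Real.pi ^ 2 * β * c) with hM
  have hM0 : 0 < M := by positivity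
  have hLinv : Tendsto (fun n => 1 / L n) atTop (nhds 0) := hL.const_div_atTop 1
  have ht : Tendsto (fun n => Real.sqrt (L n)) atTop atTop := Real.tendsto_sqrt_atTop.comp hL
  have htinv : Tendsto (fun n => M / Real.sqrt (L n)) atTop (nhds 0) := ht.const_div_atTop M
  have hX : ∀ᶠ n in atTop, (N n : ℝ) / P n ≤ K := by
    filter_upwards [hPlow, hNup] with n h1 h2
    have hLd : 0 < L n ^ d := pow_pos (hLpos n) d
    have hC0 : 0 ≤ C := by
      have : 0 ≤ C * L n ^ d := (Nat.cast_nonneg _).trans h2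
      by_contra h; push Not at h
      nlinarith
    rw [div_le_iff₀ (hP0 n), hK]
    calc (N n : ℝ) ≤ C * L n ^ d := h2
      _ = C / c * (c * L n ^ d) := by field_simp
      _ ≤ _ := mul_le_mul_of_nonneg_left h1 (by positivity)
  have hLP : ∀ᶠ n in atTop, c * L n ≤ P n := by
    filter_upwards [hPlow, hL4] with n h1 h2
    refine le_trans (mul_le_mul_of_nonneg_left ?_ hc0.le) h1
    exact le_self_pow₀ (by linarith) (by omega)
  have hPinv : Tendsto (fun n => 1 / P n) atTop (nhds 0) := by
    have : Tendsto P atTop atTop := tendsto_atTop_mono' _ hLP (hL.const_mul_atTop hc0)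
    exact this.const_div_atTop 1
  have hXP : Tendsto (fun n => (N n : ℝ) / P n * (1 / P n)) atTop (nhds 0) := by
    refine squeeze_zero' (g := fun n => K * (1 / P n)) ?_ ?_ (by simpa using hPinv.const_mul K)
    · exact Eventually.of_forall fun n => by have := hP0 n; positivity
    · filter_upwards [hX] with n h1
      have := hP0 n
      exact mul_le_mul_of_nonneg_right h1 (by positivity)
  have hXL : Tendsto (fun n => M / L n * ((N n : ℝ) / P n)) atTop (nhds 0) := by
    refine squeeze_zero' (g := fun n => M * K * (1 / L n)) ?_ ?_ (by simpa using hLinv.const_mul (M * K))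
    · exact Eventually.of_forall fun n => by have := hP0 n; have := hLpos n; positivity
    · filter_upwards [hX] with n h1
      have := hLpos n
      calc M / L n * ((N n : ℝ) / P n) ≤ M / L n * K := mul_le_mul_of_nonneg_left h1 (by positivity)
        _ = _ := by ring
  have hT1 : Tendsto (fun n => |Real.exp (-1 + M / L n * (N n / P n) - 1 / P n + (N n + 1) / P n ^ 2)
      - Real.exp (-1)|) atTop (nhds 0) := by
    have h1 : Tendsto (fun n => -1 + M / L n * (N n / P n) - 1 / P n + (N n + 1) / P n ^ 2) atTop
        (nhds (-1)) := by
      have h := (((hXL.const_add (-1)).sub hPinv).add hXP).add (hPinv.pow 2)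
      simp only [ne_eq, OfNat.ofNat_ne_zero, not_false_eq_true, zero_pow, add_zero, sub_zero] at h
      refine h.congr fun n => ?_
      have := (hP0 n).ne'
      field_simp
      ring
    have h2 := (((Real.continuous_exp.tendsto _).comp h1).sub_const (Real.exp (-1))).abs
    simpa using h2
  have hT2 : Tendsto (fun n => |Real.exp (-1) - Real.exp (-1 - 1 / P n)|) atTop (nhds 0) := by
    have h1 := hPinv.const_sub (-1)
    have h2 := (((Real.continuous_exp.tendsto _).comp h1).const_sub (Real.exp (-1))).abs
    simpa using h2
  have hT3 : Tendsto (fun n => C * Real.exp (M * K + K / c) *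
      ((Real.sqrt (L n)) ^ (2 * d) * Real.exp (-Real.sqrt (L n)))) atTop (nhds 0) := by
    have := ((Real.tendsto_pow_mul_exp_neg_atTop_nhds_zero (2 * d)).comp ht).const_mul
      (C * Real.exp (M * K + K / c))
    simpa using this
  rw [tendsto_iff_norm_sub_tendsto_zero]
  have hB0 := (hT1.add hT2).add hT3
  simp only [add_zero] at hB0
  refine squeeze_zero' (Eventually.of_forall fun n => norm_nonneg _) ?_ hB0
  filter_upwards [hPlow, hNup, hL4, hX, hLP, htinv.eventually (gt_mem_nhds (by norm_num : (0 : ℝ) < 1 / 2))]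
    with n h1 h2 h3 h4 h5 h6
  have hLn := hLpos n
  have hPn := hP0 n
  have hs2 : Real.sqrt (L n) ^ 2 = L n := Real.sq_sqrt hLn.le
  have ht2 : 2 ≤ Real.sqrt (L n) := Real.le_sqrt_of_sq_le (by linarith)
  have htμ : Real.sqrt (L n) * (M / L n) = M / Real.sqrt (L n) := by
    have : Real.sqrt (L n) ≠ 0 := by linarith
    nth_rewrite 2 [← hs2]
    field_simp
  have hcore := core_bound (0 : Fin d → ℤ) (pk d β (L n) (z n))
    (pk_nonneg d β (L n) (z n) hβ (hz n).1) (hsum n) (P := P n) (μ := M / L n)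
    (t := Real.sqrt (L n)) (N n) (pk_zero _ _ _ _) (hz n).2 hPn (by positivity)
    (by
      intro k hk
      refine (pk_le_Gk d β (L n) (z n) hβ hLn (hz n).1 k hk).trans
        ((Gk_le d β (L n) hβ hLn k hk).trans ?_)
      have hpow : L n ^ 3 ≤ L n ^ d := pow_le_pow_right₀ (by linarith) (by omega)
      calc L n ^ 2 / (4 * Real.pi ^ 2 * β) = M / L n * (c * L n ^ 3) := by
            rw [hM]; field_simp
        _ ≤ M / L n * P n := by
            apply mul_le_mul_of_nonneg_left _ (by positivity)
            exact (mul_le_mul_of_nonneg_left hpow hc0.le).trans h1)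
    (by linarith) (by rw [htμ]; exact h6.le)
  have eexp : ((Real.exp 1)⁻¹ : ℂ) = ((Real.exp (-1) : ℝ) : ℂ) := by
    rw [Real.exp_neg]; push_cast; rfl
  rw [eexp]
  refine hcore.trans ?_
  gcongr ?_ + ?_ + ?_
  · exact le_rfl
  · exact le_rfl
  have hX0 : 0 ≤ (N n : ℝ) / P n := by positivity
  have e1 : Real.sqrt (L n) ^ 2 * (M / L n) = M := by rw [hs2]; field_simp
  have e2 : (N n : ℝ) * (Real.sqrt (L n) / P n) ^ 2 = (N n : ℝ) / P n * (L n / P n) := by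
    rw [div_pow, hs2]; field_simp
  have e3 : L n / P n ≤ 1 / c := by
    rw [div_le_div_iff₀ hPn hc0]; linarith
  have e4 : (N n : ℝ) / P n * (L n / P n) ≤ K / c := by
    calc _ ≤ K * (1 / c) := mul_le_mul h4 e3 (by positivity) (hX0.trans h4)
      _ = _ := by ring
  have e5 : P n / (Real.sqrt (L n) - 1) ≤ C * L n ^ d := by
    refine (div_le_self hPn.le (by linarith)).trans ((hPN n).trans h2)
  have e6 : L n ^ d = Real.sqrt (L n) ^ (2 * d) := by rw [pow_mul, hs2]
  rw [e1, e2]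
  calc P n / (Real.sqrt (L n) - 1) * Real.exp (-Real.sqrt (L n) + M * (N n / P n) +
        (N n : ℝ) / P n * (L n / P n))
      ≤ C * L n ^ d * Real.exp (-Real.sqrt (L n) + (M * K + K / c)) := by
        apply mul_le_mul e5 _ (Real.exp_pos _).le ((Nat.cast_nonneg _).trans h2)
        apply Real.exp_le_exp.2
        have := mul_le_mul_of_nonneg_left h4 hM0.le
        linarith
    _ = _ := by rw [Real.exp_add, e6]; ring
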